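/- Let G be a finite cubic (3-regular) simple graph. Then G covers the complete graph K_4 if and only if the square G² of G admits a proper coloring with 4 colors. -/

import Mathlib

open SimpleGraph

/-- A graph homomorphism `f : G →g H` is *locally bijective* if for every vertex `v`,
`f` maps the closed neighborhood of `v` in `G` bijectively onto the closed
neighborhood of `f v` in `H`. -/
def LocallyBijective {V W : Type*} (G : SimpleGraph V) (H : SimpleGraph W)
    (f : G →g H) : Prop :=
  ∀ v : V, Set.BijOn f (insert v (G.neighborSet v)) (insert (f v) (H.neighborSet (f v)))

/-- The square `G²` of a simple graph `G`: two distinct vertices are adjacent iff they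
are adjacent in `G` or have a common neighbor in `G`. -/
def graphSquare {V : Type*} (G : SimpleGraph V) : SimpleGraph V :=
  SimpleGraph.fromRel (fun u v => G.Adj u v ∨ ∃ w, G.Adj u w ∧ G.Adj w v)

/-- Two distinct vertices are adjacent in the square iff some closed neighborhood contains both. -/
theorem graphSquare_adj_iff {V : Type*} (G : SimpleGraph V) (u v : V) :
    (graphSquare G).Adj u v ↔
      u ≠ v ∧ ∃ w, u ∈ insert w (G.neighborSet w) ∧ v ∈ insert w (G.neighborSet w) := by
  simp only [graphSquare, SimpleGraph.fromRel_adj, Set.mem_insert_iff,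
    SimpleGraph.mem_neighborSet]
  refine and_congr_right fun hne => ⟨?_, ?_⟩
  · rintro ((h | ⟨w, h₁, h₂⟩) | (h | ⟨w, h₁, h₂⟩))
    · exact ⟨u, Or.inl rfl, Or.inr h⟩
    · exact ⟨w, Or.inr h₁.symm, Or.inr h₂⟩
    · exact ⟨v, Or.inr h, Or.inl rfl⟩
    · exact ⟨w, Or.inr h₂, Or.inr h₁.symm⟩
  · rintro ⟨w, rfl | h₁, rfl | h₂⟩
    · exact absurd rfl hne
    · exact Or.inl (Or.inl h₂)
    · exact Or.inr (Or.inl h₁)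
    · exact Or.inl (Or.inr ⟨w, h₁.symm, h₂⟩)

theorem insert_neighborSet_completeGraph {W : Type*} (a : W) :
    insert a ((completeGraph W).neighborSet a) = Set.univ := by
  ext b
  simp [eq_comm, em]

theorem SimpleGraph.IsRegularOfDegree.ncard_insert_neighborSet {V : Type*} {G : SimpleGraph V}
    [G.LocallyFinite] {d : ℕ} (hG : G.IsRegularOfDegree d) (v : V) :
    (insert v (G.neighborSet v)).ncard = d + 1 := by
  rw [Set.ncard_insert_of_notMem (by simp) (Set.toFinite _), Set.ncard_eq_toFinset_card']
  exact congrArg (· + 1) (hG v)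

/-- A finite cubic graph `G` covers `K_4` iff its square is 4-colorable. -/
theorem cubic_covers_K4_iff_square_colorable {V : Type*} [Fintype V]
    (G : SimpleGraph V) [DecidableRel G.Adj] (hG : G.IsRegularOfDegree 3) :
    (∃ f : G →g completeGraph (Fin 4), LocallyBijective G (completeGraph (Fin 4)) f) ↔
      (graphSquare G).Colorable 4 := by
  constructor
  · rintro ⟨f, hf⟩
    refine ⟨SimpleGraph.Coloring.mk f fun {u v} huv heq => ?_⟩
    obtain ⟨hne, w, hu, hv⟩ := (graphSquare_adj_iff G u v).1 huv
    exact hne ((hf w).injOn hu hv heq)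
  · rintro ⟨c⟩
    have hinj (w : V) : Set.InjOn c (insert w (G.neighborSet w)) := fun u hu v hv heq => by
      by_contra hne
      exact c.valid ((graphSquare_adj_iff G u v).2 ⟨hne, w, hu, hv⟩) heq
    refine ⟨⟨c, fun {u v} huv => ?_⟩, fun v => ?_⟩
    · exact c.valid ((graphSquare_adj_iff G u v).2
        ⟨huv.ne, u, Set.mem_insert _ _, Set.mem_insert_of_mem _ huv⟩)
    · rw [insert_neighborSet_completeGraph]
      have himage : c '' insert v (G.neighborSet v) = Set.univ := by
        refine Set.eq_of_subset_of_ncard_le (Set.subset_univ _) ?_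
        rw [(hinj v).ncard_image, hG.ncard_insert_neighborSet]
        simp
      exact himage ▸ (hinj v).bijOn_image
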